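/- arXiv:2311.11987 — 3 statements merged into one kernel-verified Lean document; each statement's English description precedes it below -/
import Mathlib

section
/- Let F be any field and let n satisfy 4 ≤ n ≤ 8. Then there exists a nilpotent symplectic alternating algebra over F of dimension 2n whose center has dimension 2, and the minimum of the nilpotency classes of all nilpotent symplectic alternating algebras over F of dimension 2n with dim Z(L) = 2 equals 2m+1 if Ω(m) < n ≤ (Ω(m)+Ω(m+1))/2 and equals 2m+2 if (Ω(m)+Ω(m+1))/2 < n ≤ Ω(m+1); explicitly, this minimum is 5 for n = 4, 6 for n = 5, and 7 for n ∈ {6, 7, 8}. -/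
/-- A symplectic alternating algebra structure on an `F`-vector space `L`:
a nondegenerate alternating bilinear form together with an alternating
bilinear product satisfying `(x·y, z) = (y·z, x)`. -/
structure SAAStruct (F : Type*) [Field F] (L : Type*) [AddCommGroup L] [Module F L] where
  form : L →ₗ[F] L →ₗ[F] F
  mul : L →ₗ[F] L →ₗ[F] L
  form_alt : ∀ x : L, form x x = 0
  form_nondegen : ∀ x : L, (∀ y : L, form x y = 0) → x = 0
  mul_alt : ∀ x : L, mul x x = 0
  cyclic : ∀ x y z : L, form (mul x y) z = form (mul y z) x

namespace SAAStruct

variable {F : Type*} [Field F] {L : Type*} [AddCommGroup L] [Module F L]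

/-- `I` is an ideal of the symplectic alternating algebra `A`. -/
def IsIdealSub (A : SAAStruct F L) (I : Submodule F L) : Prop :=
  ∀ x ∈ I, ∀ y : L, A.mul x y ∈ I

/-- An ascending chain of ideals `⊥ = I 0 ≤ I 1 ≤ ⋯ ≤ I k = ⊤`
with `I (s+1) · L ⊆ I s`. -/
def CentralChain (A : SAAStruct F L) (I : ℕ → Submodule F L) (k : ℕ) : Prop :=
  I 0 = ⊥ ∧ I k = ⊤ ∧ (∀ s, s < k → I s ≤ I (s + 1)) ∧
  (∀ s, s ≤ k → A.IsIdealSub (I s)) ∧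
  (∀ s, s < k → ∀ x ∈ I (s + 1), ∀ y : L, A.mul x y ∈ I s)

/-- `A` is nilpotent if it admits a central chain of ideals. -/
def IsNilpotent (A : SAAStruct F L) : Prop :=
  ∃ (k : ℕ) (I : ℕ → Submodule F L), A.CentralChain I k

/-- The nilpotency class of `A`: the least length of a central chain of ideals. -/
noncomputable def nilClass (A : SAAStruct F L) : ℕ :=
  sInf {k | ∃ I : ℕ → Submodule F L, A.CentralChain I k}

/-- The center `Z(L) = {x : x·L = 0}`. -/
def center (A : SAAStruct F L) : Submodule F L := LinearMap.ker A.mul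

/-- The lower central series, indexed so that `lcs A i` is `L^(i+1)`:
`lcs A 0 = L¹ = L` and `lcs A (i+1) = L^(i+2) = span {u·v : u ∈ L^(i+1), v ∈ L}`. -/
def lcs (A : SAAStruct F L) : ℕ → Submodule F L
  | 0 => ⊤
  | (i + 1) => Submodule.span F {z | ∃ u ∈ A.lcs i, ∃ v : L, z = A.mul u v}

/-- The upper central series: `ucs A 0 = 0`, `ucs A (i+1) = {x : x·L ⊆ ucs A i}`. -/
def ucs (A : SAAStruct F L) : ℕ → Submodule F L
  | 0 => ⊥
  | (i + 1) =>
    { carrier := {x | ∀ y : L, A.mul x y ∈ A.ucs i}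
      add_mem' := by
        intro a b ha hb y
        simpa [map_add, LinearMap.add_apply] using
          Submodule.add_mem _ (ha y) (hb y)
      zero_mem' := by
        intro y
        simp
      smul_mem' := by
        intro c a ha y
        simpa [map_smul, LinearMap.smul_apply] using
          Submodule.smul_mem _ c (ha y) }

/-- The perp `U^⊥ = {x : (x,u) = 0 for all u ∈ U}` of a subspace with
respect to the alternating form of `A`. -/
def perp (A : SAAStruct F L) (U : Submodule F L) : Submodule F L :=
  { carrier := {x | ∀ u ∈ U, A.form x u = 0}
    add_mem' := by
      intro a b ha hb u hu
      simp [map_add, LinearMap.add_apply, ha u hu, hb u hu]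
    zero_mem' := by
      intro u hu
      simp
    smul_mem' := by
      intro c a ha u hu
      simp [map_smul, LinearMap.smul_apply, ha u hu] }

/-- A subspace is isotropic if the form vanishes identically on it. -/
def Isotropic (A : SAAStruct F L) (U : Submodule F L) : Prop :=
  ∀ u ∈ U, ∀ v ∈ U, A.form u v = 0

/-- A subspace is abelian if the product vanishes identically on it. -/
def AbelianSub (A : SAAStruct F L) (U : Submodule F L) : Prop :=
  ∀ u ∈ U, ∀ v ∈ U, A.mul u v = 0

end SAAStruct

/-- The function `Ω` with `Ω 0 = 0` and `Ω (m+1) = 2 + C(Ω m, 2)`. -/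
def OmegaFn : ℕ → ℕ
  | 0 => 0
  | (m + 1) => 2 + Nat.choose (OmegaFn m) 2

/-- The entries of the Gram matrix of a standard (symplectic) basis
`x₁, y₁, x₂, y₂, …` enumerated as `b 0 = x₁, b 1 = y₁, b 2 = x₂, …`. -/
def stdJ (F : Type*) [Field F] {N : ℕ} (i j : Fin N) : F :=
  if (i : ℕ) % 2 = 0 ∧ (j : ℕ) = (i : ℕ) + 1 then 1
  else if (j : ℕ) % 2 = 0 ∧ (i : ℕ) = (j : ℕ) + 1 then -1
  else 0

/-- A symplectic alternating algebra over `F`, bundled with its carrier space. -/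
structure SAABundle (F : Type) [Field F] where
  carrier : Type
  [grp : AddCommGroup carrier]
  [mod : Module F carrier]
  alg : SAAStruct F carrier

attribute [instance] SAABundle.grp SAABundle.mod

/-- The set of nilpotency classes occurring among nilpotent symplectic
alternating algebras over `F` of dimension `2n` with 2-dimensional center. -/
def classSet (F : Type) [Field F] (n : ℕ) : Set ℕ :=
  {k | ∃ B : SAABundle F,
        FiniteDimensional F B.carrier ∧
        B.alg.IsNilpotent ∧
        Module.finrank F B.carrier = 2 * n ∧
        Module.finrank F B.alg.center = 2 ∧
        B.alg.nilClass = k}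

namespace SAAStruct

section Duality

variable {F : Type*} [Field F] {L : Type*} [AddCommGroup L] [Module F L]

theorem form_swap (A : SAAStruct F L) (x y : L) : A.form x y = -A.form y x :=
  (LinearMap.IsAlt.neg A.form_alt y x).symm

theorem mul_swap (A : SAAStruct F L) (x y : L) : A.mul x y = -A.mul y x :=
  (LinearMap.IsAlt.neg A.mul_alt y x).symm

theorem form_mul_right (A : SAAStruct F L) (x u v : L) :
    A.form x (A.mul u v) = A.form (A.mul x v) u := by
  rw [A.form_swap, A.cyclic, A.mul_swap, map_neg, LinearMap.neg_apply, neg_neg]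

theorem mul_mem_lcs_succ (A : SAAStruct F L) {i : ℕ} {u : L} (hu : u ∈ A.lcs i) (v : L) :
    A.mul u v ∈ A.lcs (i + 1) :=
  Submodule.subset_span ⟨u, hu, v, rfl⟩

theorem mul_mem_lcs_succ_right (A : SAAStruct F L) {i : ℕ} {u : L} (hu : u ∈ A.lcs i) (v : L) :
    A.mul v u ∈ A.lcs (i + 1) := by
  rw [A.mul_swap]
  exact neg_mem (A.mul_mem_lcs_succ hu v)

theorem finrank_perp_add [FiniteDimensional F L] (A : SAAStruct F L) (W : Submodule F L) :
    Module.finrank F (A.perp W) + Module.finrank F W = Module.finrank F L := by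
  have hinj : Function.Injective A.form := by
    rw [← LinearMap.ker_eq_bot, LinearMap.ker_eq_bot']
    intro x hx
    exact A.form_nondegen x fun y => by rw [hx, LinearMap.zero_apply]
  let e : L ≃ₗ[F] Module.Dual F L :=
    LinearEquiv.ofInjectiveOfFinrankEq A.form hinj Subspace.dual_finrank_eq.symm
  have hmap : A.perp W = W.dualAnnihilator.comap (e : L →ₗ[F] Module.Dual F L) := by
    ext x
    rw [Submodule.mem_comap, Submodule.mem_dualAnnihilator]
    rfl
  have hW := Subspace.finrank_add_finrank_dualAnnihilator_eq W
  have he : Module.finrank F (A.perp W) = Module.finrank F W.dualAnnihilator := by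
    rw [hmap]
    exact (e.ofSubmodule' W.dualAnnihilator).finrank_eq
  omega

theorem perp_lcs_one_le_center (A : SAAStruct F L) : A.perp (A.lcs 1) ≤ A.center := by
  intro x hx
  change A.mul x = 0
  ext v
  refine A.form_nondegen _ fun u => ?_
  rw [← A.form_mul_right]
  exact hx _ (A.mul_mem_lcs_succ (i := 0) Submodule.mem_top v)

theorem lcs_le_of_centralChain (A : SAAStruct F L) {I : ℕ → Submodule F L} {k : ℕ}
    (h : A.CentralChain I k) (i j : ℕ) (hij : i + j = k) : A.lcs i ≤ I j := by
  induction i generalizing j with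
  | zero =>
    obtain rfl : j = k := by omega
    rw [h.2.1]
    exact le_top
  | succ i ih =>
    refine Submodule.span_le.2 ?_
    rintro _ ⟨u, hu, v, rfl⟩
    exact h.2.2.2.2 j (by omega) u (ih (j + 1) (by omega) hu) v

theorem le_perp_lcs_of_centralChain (A : SAAStruct F L) {I : ℕ → Submodule F L} {k : ℕ}
    (h : A.CentralChain I k) (s : ℕ) (hs : s ≤ k) : I s ≤ A.perp (A.lcs s) := by
  induction s with
  | zero =>
    rw [h.1]
    exact bot_le
  | succ s ih =>
    intro x hx y hy
    have hle : A.lcs (s + 1) ≤ LinearMap.ker (A.form x) := by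
      refine Submodule.span_le.2 ?_
      rintro _ ⟨u, hu, v, rfl⟩
      change A.form x (A.mul u v) = 0
      rw [A.form_mul_right]
      exact ih (by omega) (h.2.2.2.2 s (by omega) x hx v) u hu
    exact hle hy

theorem finrank_lcs_add_le [FiniteDimensional F L] (A : SAAStruct F L)
    {I : ℕ → Submodule F L} {k : ℕ} (h : A.CentralChain I k) (i j : ℕ) (hij : i + j = k) :
    Module.finrank F (A.lcs i) + Module.finrank F (A.lcs j) ≤ Module.finrank F L := by
  have h1 := A.finrank_perp_add (A.lcs j)
  have h2 := Submodule.finrank_mono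
    ((A.lcs_le_of_centralChain h i j hij).trans (A.le_perp_lcs_of_centralChain h j (by omega)))
  omega

/-- The product restricted to a subspace, as an alternating map in two variables. -/
def mulAlternating (A : SAAStruct F L) (C : Submodule F L) : C [⋀^Fin 2]→ₗ[F] L where
  toFun v := A.mul (v 0) (v 1)
  map_update_add' := by
    intro _ v i x y
    fin_cases i <;> simp [Function.update]
  map_update_smul' := by
    intro _ v i c x
    fin_cases i <;> simp [Function.update]
  map_eq_zero_of_eq' := by
    intro v i j hv hij
    have h01 : v 0 = v 1 := by
      fin_cases i <;> fin_cases j <;> simp_all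
    rw [h01, A.mul_alt]

theorem exists_submodule_products [FiniteDimensional F L] (A : SAAStruct F L)
    (C : Submodule F L) :
    ∃ P : Submodule F L, (∀ x ∈ C, ∀ y ∈ C, A.mul x y ∈ P) ∧
      Module.finrank F P ≤ (Module.finrank F C).choose 2 := by
  refine ⟨LinearMap.range (exteriorPower.alternatingMapLinearEquiv (A.mulAlternating C)), ?_, ?_⟩
  · intro x hx y hy
    refine ⟨exteriorPower.ιMulti F 2 ![⟨x, hx⟩, ⟨y, hy⟩], ?_⟩
    rw [exteriorPower.alternatingMapLinearEquiv_apply_ιMulti]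
    rfl
  · rw [← exteriorPower.finrank_eq F (M := C)]
    exact LinearMap.finrank_range_le _

theorem finrank_lcs_one_le [FiniteDimensional F L] (A : SAAStruct F L) (i : ℕ) :
    Module.finrank F (A.lcs 1) ≤ Module.finrank F (A.lcs (i + 1)) +
      (Module.finrank F L - Module.finrank F (A.lcs i)).choose 2 := by
  obtain ⟨C, hC⟩ := (A.lcs i).exists_isCompl
  obtain ⟨P, hP, hPd⟩ := A.exists_submodule_products C
  have hle : A.lcs 1 ≤ A.lcs (i + 1) ⊔ P := by
    refine Submodule.span_le.2 ?_
    rintro _ ⟨u, -, v, rfl⟩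
    have htop := hC.sup_eq_top
    obtain ⟨a, ha, b, hb, rfl⟩ := Submodule.mem_sup.1 (htop ▸ Submodule.mem_top (x := u))
    obtain ⟨a', ha', b', hb', rfl⟩ := Submodule.mem_sup.1 (htop ▸ Submodule.mem_top (x := v))
    have hsplit : A.mul (a + b) (a' + b') = (A.mul a (a' + b') + A.mul b a') + A.mul b b' := by
      simp only [map_add, LinearMap.add_apply]
      abel
    rw [hsplit]
    exact Submodule.add_mem_sup
      (add_mem (A.mul_mem_lcs_succ ha _) (A.mul_mem_lcs_succ_right ha' _)) (hP b hb b' hb')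
  have h1 := Submodule.finrank_mono hle
  have h2 := Submodule.finrank_add_le_finrank_add_finrank (A.lcs (i + 1)) P
  have h3 := Submodule.finrank_add_eq_of_isCompl hC
  have h4 : Module.finrank F L - Module.finrank F (A.lcs i) = Module.finrank F C := by omega
  rw [h4]
  omega

theorem finrank_le_lcs_add_OmegaFn [FiniteDimensional F L] (A : SAAStruct F L)
    (hc : Module.finrank F A.center = 2) (i : ℕ) :
    Module.finrank F L ≤ Module.finrank F (A.lcs i) + OmegaFn i := by
  induction i with
  | zero =>
    have : Module.finrank F (A.lcs 0) = Module.finrank F L := finrank_top F L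
    omega
  | succ i ih =>
    have h1 := A.finrank_perp_add (A.lcs 1)
    have h2 := Submodule.finrank_mono A.perp_lcs_one_le_center
    have h3 := A.finrank_lcs_one_le i
    have h4 : (Module.finrank F L - Module.finrank F (A.lcs i)).choose 2 ≤ (OmegaFn i).choose 2 :=
      Nat.choose_le_choose 2 (by omega)
    have h5 : OmegaFn (i + 1) = 2 + (OmegaFn i).choose 2 := rfl
    omega

theorem finrank_le_OmegaFn_add [FiniteDimensional F L] (A : SAAStruct F L)
    (hn : A.IsNilpotent) (hc : Module.finrank F A.center = 2) (i j : ℕ)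
    (hij : i + j = A.nilClass) :
    Module.finrank F L ≤ OmegaFn i + OmegaFn j := by
  obtain ⟨I, hI⟩ : ∃ I : ℕ → Submodule F L, A.CentralChain I A.nilClass :=
    Nat.sInf_mem (s := {k | ∃ I : ℕ → Submodule F L, A.CentralChain I k}) hn
  have h1 := A.finrank_lcs_add_le hI i j hij
  have h2 := A.finrank_le_lcs_add_OmegaFn hc i
  have h3 := A.finrank_le_lcs_add_OmegaFn hc j
  omega

end Duality

section Monomial

variable (F : Type*) [Field F] {n : ℕ} {κ : Type*} [Fintype κ]

/-- The standard symplectic form on coordinate vectors indexed by `Fin n ⊕ Fin n`. -/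
def stdForm (n : ℕ) :
    (Fin n ⊕ Fin n → F) →ₗ[F] (Fin n ⊕ Fin n → F) →ₗ[F] F :=
  LinearMap.mk₂ F
    (fun x y => ∑ i : Fin n, (x (Sum.inl i) * y (Sum.inr i) - x (Sum.inr i) * y (Sum.inl i)))
    (by intro x x' y; rw [← Finset.sum_add_distrib]; simp only [Pi.add_apply]; congr; ext; ring)
    (by intro c x y; rw [Finset.smul_sum]; simp only [Pi.smul_apply, smul_eq_mul]
        congr; ext; ring)
    (by intro x y y'; rw [← Finset.sum_add_distrib]; simp only [Pi.add_apply]; congr; ext; ring)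
    (by intro c x y; rw [Finset.smul_sum]; simp only [Pi.smul_apply, smul_eq_mul]
        congr; ext; ring)

/-- The vector representing the `i`-th coordinate functional with respect to `stdForm`. -/
def coordVec : Fin n ⊕ Fin n → (Fin n ⊕ Fin n → F)
  | Sum.inl i => Pi.single (Sum.inr i) (-1)
  | Sum.inr i => Pi.single (Sum.inl i) 1

variable {F}

theorem stdForm_coordVec (i : Fin n ⊕ Fin n) (z : Fin n ⊕ Fin n → F) :
    stdForm F n (coordVec F i) z = z i := by
  rcases i with i | i <;>
    simp [stdForm, coordVec, Pi.single_apply]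

theorem stdForm_self (x : Fin n ⊕ Fin n → F) : stdForm F n x x = 0 := by
  simp only [stdForm, LinearMap.mk₂_apply]
  exact Finset.sum_eq_zero fun i _ => by ring

theorem coordVec_apply_eq_zero {i j : Fin n ⊕ Fin n} (h : j ≠ i.swap) :
    coordVec F i j = 0 := by
  rcases i with i | i <;> exact Pi.single_eq_of_ne h _

/-- The `2 × 2` minor of two vectors at the coordinates `i`, `j`. -/
def minor (x y : Fin n ⊕ Fin n → F) (i j : Fin n ⊕ Fin n) : F :=
  x i * y j - x j * y i

/-- The product attached to the alternating 3-form `∑ e_p* ∧ e_q* ∧ e_r*`, the sum being over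
the triples `(p, q, r)` in the family `t`. -/
def monomialMul (t : κ → (Fin n ⊕ Fin n) × (Fin n ⊕ Fin n) × (Fin n ⊕ Fin n)) :
    (Fin n ⊕ Fin n → F) →ₗ[F] (Fin n ⊕ Fin n → F) →ₗ[F] (Fin n ⊕ Fin n → F) :=
  LinearMap.mk₂ F
    (fun x y => ∑ a, (minor x y (t a).1 (t a).2.1 • coordVec F (t a).2.2 +
      minor x y (t a).2.1 (t a).2.2 • coordVec F (t a).1 +
      minor x y (t a).2.2 (t a).1 • coordVec F (t a).2.1))
    (by intro x x' y; rw [← Finset.sum_add_distrib]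
        simp only [minor, Pi.add_apply]; congr; ext1; module)
    (by intro c x y; rw [Finset.smul_sum]
        simp only [minor, Pi.smul_apply, smul_eq_mul]; congr; ext1; module)
    (by intro x x' y; rw [← Finset.sum_add_distrib]
        simp only [minor, Pi.add_apply]; congr; ext1; module)
    (by intro c x y; rw [Finset.smul_sum]
        simp only [minor, Pi.smul_apply, smul_eq_mul]; congr; ext1; module)

theorem monomialMul_apply (t : κ → (Fin n ⊕ Fin n) × (Fin n ⊕ Fin n) × (Fin n ⊕ Fin n))
    (x y : Fin n ⊕ Fin n → F) :
    monomialMul t x y = ∑ a, (minor x y (t a).1 (t a).2.1 • coordVec F (t a).2.2 +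
      minor x y (t a).2.1 (t a).2.2 • coordVec F (t a).1 +
      minor x y (t a).2.2 (t a).1 • coordVec F (t a).2.1) := rfl

theorem stdForm_monomialMul (t : κ → (Fin n ⊕ Fin n) × (Fin n ⊕ Fin n) × (Fin n ⊕ Fin n))
    (x y z : Fin n ⊕ Fin n → F) :
    stdForm F n (monomialMul t x y) z = ∑ a, (minor x y (t a).1 (t a).2.1 * z (t a).2.2 +
      minor x y (t a).2.1 (t a).2.2 * z (t a).1 +
      minor x y (t a).2.2 (t a).1 * z (t a).2.1) := by
  simp only [monomialMul_apply, map_sum, LinearMap.sum_apply, map_add, LinearMap.add_apply,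
    map_smul, LinearMap.smul_apply, stdForm_coordVec, smul_eq_mul]

variable (F) in
/-- The symplectic alternating algebra whose 3-form is the sum of the monomials in `t`. -/
def monomialAlgebra (t : κ → (Fin n ⊕ Fin n) × (Fin n ⊕ Fin n) × (Fin n ⊕ Fin n)) :
    SAAStruct F (Fin n ⊕ Fin n → F) where
  form := stdForm F n
  mul := monomialMul t
  form_alt := stdForm_self
  form_nondegen x hx := by
    ext i
    have hneg := LinearMap.IsAlt.neg (B := stdForm F n) stdForm_self x (coordVec F i)
    rw [hx, neg_zero, stdForm_coordVec] at hneg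
    exact hneg.symm
  mul_alt x := by
    rw [monomialMul_apply]
    refine Finset.sum_eq_zero fun a _ => ?_
    simp only [minor]
    module
  cyclic x y z := by
    rw [stdForm_monomialMul, stdForm_monomialMul]
    refine Finset.sum_congr rfl fun a _ => ?_
    simp only [minor]
    ring

/-- The pair `i`, `j` lies in no triple of the family `t` other than `t a`. -/
def PairUniqueAt (t : κ → (Fin n ⊕ Fin n) × (Fin n ⊕ Fin n) × (Fin n ⊕ Fin n)) (a : κ)
    (i j : Fin n ⊕ Fin n) : Prop :=
  ∀ b, b ≠ a → (i ≠ (t b).1 ∧ i ≠ (t b).2.1 ∧ i ≠ (t b).2.2) ∨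
    (j ≠ (t b).1 ∧ j ≠ (t b).2.1 ∧ j ≠ (t b).2.2)

instance [DecidableEq κ] (t : κ → (Fin n ⊕ Fin n) × (Fin n ⊕ Fin n) × (Fin n ⊕ Fin n)) (a : κ)
    (i j : Fin n ⊕ Fin n) : Decidable (PairUniqueAt t a i j) :=
  inferInstanceAs (Decidable (∀ b, b ≠ a → _))

/-- The three entries of a triple are pairwise distinct. -/
def TripleDistinct (s : (Fin n ⊕ Fin n) × (Fin n ⊕ Fin n) × (Fin n ⊕ Fin n)) : Prop :=
  s.1 ≠ s.2.1 ∧ s.2.1 ≠ s.2.2 ∧ s.2.2 ≠ s.1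

instance (s : (Fin n ⊕ Fin n) × (Fin n ⊕ Fin n) × (Fin n ⊕ Fin n)) :
    Decidable (TripleDistinct s) :=
  inferInstanceAs (Decidable (_ ∧ _ ∧ _))

theorem stdForm_monomialMul_single_single
    (t : κ → (Fin n ⊕ Fin n) × (Fin n ⊕ Fin n) × (Fin n ⊕ Fin n)) (a : κ)
    {i j : Fin n ⊕ Fin n} (h : PairUniqueAt t a i j) (x : Fin n ⊕ Fin n → F) :
    stdForm F n (monomialMul t (Pi.single i 1) (Pi.single j 1)) x =
      minor (Pi.single i 1) (Pi.single j 1) (t a).1 (t a).2.1 * x (t a).2.2 +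
      minor (Pi.single i 1) (Pi.single j 1) (t a).2.1 (t a).2.2 * x (t a).1 +
      minor (Pi.single i 1) (Pi.single j 1) (t a).2.2 (t a).1 * x (t a).2.1 := by
  rw [stdForm_monomialMul]
  refine Finset.sum_eq_single a (fun b _ hb => ?_) (fun ha => absurd (Finset.mem_univ a) ha)
  rcases h b hb with ⟨h1, h2, h3⟩ | ⟨h1, h2, h3⟩ <;>
    simp [minor, Pi.single_eq_of_ne' h1, Pi.single_eq_of_ne' h2, Pi.single_eq_of_ne' h3]

/-- Some triple of the family contains `i` and is the only one containing the other two
entries. -/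
def Detected (t : κ → (Fin n ⊕ Fin n) × (Fin n ⊕ Fin n) × (Fin n ⊕ Fin n))
    (i : Fin n ⊕ Fin n) : Prop :=
  ∃ a, (i = (t a).2.2 ∧ PairUniqueAt t a (t a).1 (t a).2.1) ∨
    (i = (t a).1 ∧ PairUniqueAt t a (t a).2.1 (t a).2.2) ∨
    (i = (t a).2.1 ∧ PairUniqueAt t a (t a).2.2 (t a).1)

instance [DecidableEq κ] (t : κ → (Fin n ⊕ Fin n) × (Fin n ⊕ Fin n) × (Fin n ⊕ Fin n))
    (i : Fin n ⊕ Fin n) : Decidable (Detected t i) := by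
  unfold Detected
  infer_instance

theorem apply_eq_zero_of_mem_center
    {t : κ → (Fin n ⊕ Fin n) × (Fin n ⊕ Fin n) × (Fin n ⊕ Fin n)}
    (hd : ∀ a, TripleDistinct (t a)) {i : Fin n ⊕ Fin n} (hi : Detected t i)
    {x : Fin n ⊕ Fin n → F} (hx : x ∈ (monomialAlgebra F t).center) : x i = 0 := by
  have hzero : ∀ u v, stdForm F n (monomialMul t u v) x = 0 := by
    intro u v
    have hcyc := (monomialAlgebra F t).cyclic x u v
    have hx' : (monomialAlgebra F t).mul x = 0 := hx
    rw [hx'] at hcyc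
    rw [LinearMap.zero_apply, map_zero, LinearMap.zero_apply] at hcyc
    exact hcyc.symm
  obtain ⟨a, ⟨rfl, ha⟩ | ⟨rfl, ha⟩ | ⟨rfl, ha⟩⟩ := hi
  all_goals
    obtain ⟨h1, h2, h3⟩ := hd a
    have h := stdForm_monomialMul_single_single t a ha x
    rw [hzero] at h
    simpa [minor, Pi.single_apply, h1, h2, h3, h1.symm, h2.symm, h3.symm] using h.symm

theorem finrank_center_monomialAlgebra
    {t : κ → (Fin n ⊕ Fin n) × (Fin n ⊕ Fin n) × (Fin n ⊕ Fin n)}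
    (hd : ∀ a, TripleDistinct (t a)) (s : Finset (Fin n ⊕ Fin n))
    (hs : ∀ a, (t a).1 ∉ s ∧ (t a).2.1 ∉ s ∧ (t a).2.2 ∉ s)
    (hdet : ∀ i, i ∉ s → Detected t i) :
    Module.finrank F (monomialAlgebra F t).center = s.card := by
  have hcenter : (monomialAlgebra F t).center =
      ⨅ i ∈ (↑s : Set (Fin n ⊕ Fin n))ᶜ,
        LinearMap.ker (LinearMap.proj i : (Fin n ⊕ Fin n → F) →ₗ[F] F) := by
    ext x
    simp only [Submodule.mem_iInf, LinearMap.mem_ker, LinearMap.proj_apply]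
    constructor
    · intro hx i hi
      exact apply_eq_zero_of_mem_center hd (hdet i hi) hx
    · intro hx
      change monomialMul t x = 0
      refine LinearMap.ext fun y => ?_
      rw [monomialMul_apply]
      refine Finset.sum_eq_zero fun a _ => ?_
      obtain ⟨h1, h2, h3⟩ := hs a
      simp [minor, hx _ h1, hx _ h2, hx _ h3]
  rw [hcenter, (LinearMap.iInfKerProjEquiv F (fun _ => F)
    (disjoint_compl_right (a := (↑s : Set (Fin n ⊕ Fin n)))) (by simp)).finrank_eq]
  simp

/-- The weight on `Fin n ⊕ Fin n` extending `w` so that dual indices have weights summing to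
`c + 1`. -/
def dualWeight (w : Fin n → ℕ) (c : ℕ) : Fin n ⊕ Fin n → ℕ
  | Sum.inl i => w i
  | Sum.inr i => c + 1 - w i

theorem dualWeight_add_swap {w : Fin n → ℕ} {c : ℕ} (hw : ∀ i, w i ≤ c) (i : Fin n ⊕ Fin n) :
    dualWeight w c i + dualWeight w c i.swap = c + 1 := by
  rcases i with i | i <;> have := hw i <;> simp only [dualWeight, Sum.swap_inl, Sum.swap_inr] <;>
    omega

variable (F) in
/-- The vectors supported on the indices of weight greater than `c - s`. -/
def weightFiltration (W : Fin n ⊕ Fin n → ℕ) (c s : ℕ) :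
    Submodule F (Fin n ⊕ Fin n → F) where
  carrier := {v | ∀ i, W i + s ≤ c → v i = 0}
  add_mem' := by
    intro a b ha hb i hi
    rw [Pi.add_apply, ha i hi, hb i hi, add_zero]
  zero_mem' := fun _ _ => rfl
  smul_mem' := by
    intro r a ha i hi
    rw [Pi.smul_apply, ha i hi, smul_zero]

theorem monomialMul_mem_weightFiltration
    {t : κ → (Fin n ⊕ Fin n) × (Fin n ⊕ Fin n) × (Fin n ⊕ Fin n)}
    {W : Fin n ⊕ Fin n → ℕ} {c : ℕ} (hW : ∀ i, W i + W i.swap = c + 1)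
    (ht : ∀ a, W (t a).1 + W (t a).2.1 ≤ c ∧ W (t a).2.1 + W (t a).2.2 ≤ c ∧
      W (t a).2.2 + W (t a).1 ≤ c)
    {s : ℕ} {x : Fin n ⊕ Fin n → F} (hx : x ∈ weightFiltration F W c (s + 1))
    (y : Fin n ⊕ Fin n → F) : monomialMul t x y ∈ weightFiltration F W c s := by
  have key : ∀ i j k : Fin n ⊕ Fin n, W i + W k ≤ c → W j + W k ≤ c →
      minor x y i j • coordVec F k ∈ weightFiltration F W c s := by
    intro i j k hik hjk l hl
    by_cases hlk : l = k.swap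
    · subst hlk
      have hk := hW k
      have hi : x i = 0 := hx i (by omega)
      have hj : x j = 0 := hx j (by omega)
      simp [minor, hi, hj]
    · rw [Pi.smul_apply, coordVec_apply_eq_zero hlk, smul_zero]
  rw [monomialMul_apply]
  refine Submodule.sum_mem _ fun a _ => ?_
  obtain ⟨h1, h2, h3⟩ := ht a
  exact add_mem (add_mem (key _ _ _ (by omega) (by omega)) (key _ _ _ (by omega) (by omega)))
    (key _ _ _ (by omega) (by omega))

theorem centralChain_monomialAlgebra
    {t : κ → (Fin n ⊕ Fin n) × (Fin n ⊕ Fin n) × (Fin n ⊕ Fin n)}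
    {w : Fin n → ℕ} {c : ℕ} (hw : ∀ i, 1 ≤ w i ∧ w i ≤ c)
    (ht : ∀ a, dualWeight w c (t a).1 + dualWeight w c (t a).2.1 ≤ c ∧
      dualWeight w c (t a).2.1 + dualWeight w c (t a).2.2 ≤ c ∧
      dualWeight w c (t a).2.2 + dualWeight w c (t a).1 ≤ c) :
    (monomialAlgebra F t).CentralChain (weightFiltration F (dualWeight w c) c) c := by
  have hW := dualWeight_add_swap fun i => (hw i).2
  have hpos : ∀ i, 1 ≤ dualWeight w c i ∧ dualWeight w c i ≤ c := by
    rintro (i | i) <;> have := hw i <;> simp only [dualWeight] <;> omega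
  have hmono : ∀ s, weightFiltration F (dualWeight w c) c s ≤
      weightFiltration F (dualWeight w c) c (s + 1) :=
    fun s v hv i hi => hv i (by omega)
  have hbot : weightFiltration F (dualWeight w c) c 0 = ⊥ := by
    rw [eq_bot_iff]
    intro v hv
    rw [Submodule.mem_bot]
    ext i
    exact hv i (hpos i).2
  refine ⟨hbot, ?_, fun s _ => hmono s, ?_, ?_⟩
  · rw [eq_top_iff]
    intro v _ i hi
    have := (hpos i).1
    omega
  · intro s _ x hx y
    exact monomialMul_mem_weightFiltration hW ht (hmono s hx) y
  · intro s _ x hx y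
    exact monomialMul_mem_weightFiltration hW ht hx y

end Monomial

end SAAStruct

open SAAStruct in
theorem exists_mem_classSet_le (F : Type) [Field F] {n c : ℕ} {κ : Type} [Fintype κ]
    (t : κ → (Fin n ⊕ Fin n) × (Fin n ⊕ Fin n) × (Fin n ⊕ Fin n)) (w : Fin n → ℕ)
    (s : Finset (Fin n ⊕ Fin n)) (hcard : s.card = 2)
    (hw : ∀ i, 1 ≤ w i ∧ w i ≤ c)
    (ht : ∀ a, dualWeight w c (t a).1 + dualWeight w c (t a).2.1 ≤ c ∧
      dualWeight w c (t a).2.1 + dualWeight w c (t a).2.2 ≤ c ∧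
      dualWeight w c (t a).2.2 + dualWeight w c (t a).1 ≤ c)
    (hd : ∀ a, TripleDistinct (t a))
    (hs : ∀ a, (t a).1 ∉ s ∧ (t a).2.1 ∉ s ∧ (t a).2.2 ∉ s)
    (hdet : ∀ i, i ∉ s → Detected t i) :
    ∃ k ∈ classSet F n, k ≤ c := by
  have hchain := centralChain_monomialAlgebra (F := F) hw ht
  refine ⟨_, ⟨⟨Fin n ⊕ Fin n → F, monomialAlgebra F t⟩, inferInstance, ⟨c, _, hchain⟩, ?_, ?_,
    rfl⟩, Nat.sInf_le ⟨_, hchain⟩⟩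
  · simp [two_mul]
  · exact (finrank_center_monomialAlgebra hd s hs hdet).trans hcard

theorem exists_mem_classSet_four (F : Type) [Field F] : ∃ k ∈ classSet F 4, k ≤ 5 :=
  exists_mem_classSet_le F
    ![(.inl 0, .inl 1, .inr 2), (.inl 0, .inl 2, .inr 3), (.inl 1, .inl 2, .inl 3)]
    ![1, 1, 2, 3] {.inr 0, .inr 1} (by decide) (by decide) (by decide) (by decide) (by decide)
    (by decide)

theorem exists_mem_classSet_five (F : Type) [Field F] : ∃ k ∈ classSet F 5, k ≤ 6 :=
  exists_mem_classSet_le F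
    ![(.inl 0, .inl 1, .inr 2), (.inl 0, .inl 2, .inr 3), (.inl 1, .inl 2, .inr 4),
      (.inl 2, .inl 3, .inl 4)]
    ![1, 1, 2, 3, 3] {.inr 0, .inr 1} (by decide) (by decide) (by decide) (by decide) (by decide)
    (by decide)

theorem exists_mem_classSet_six (F : Type) [Field F] : ∃ k ∈ classSet F 6, k ≤ 7 :=
  exists_mem_classSet_le F
    ![(.inl 0, .inl 1, .inr 2), (.inl 0, .inl 2, .inr 3), (.inl 1, .inl 2, .inr 4),
      (.inl 3, .inl 4, .inl 5), (.inl 2, .inl 3, .inr 5)]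
    ![1, 1, 2, 3, 3, 4] {.inr 0, .inr 1} (by decide) (by decide) (by decide) (by decide)
    (by decide) (by decide)

theorem exists_mem_classSet_seven (F : Type) [Field F] : ∃ k ∈ classSet F 7, k ≤ 7 :=
  exists_mem_classSet_le F
    ![(.inl 0, .inl 1, .inr 2), (.inl 0, .inl 2, .inr 3), (.inl 1, .inl 2, .inr 4),
      (.inl 3, .inl 4, .inl 5), (.inl 2, .inl 3, .inr 5), (.inl 2, .inl 4, .inl 6),
      (.inl 0, .inl 3, .inr 6)]
    ![1, 1, 2, 3, 3, 4, 4] {.inr 0, .inr 1} (by decide) (by decide) (by decide) (by decide)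
    (by decide) (by decide)

theorem exists_mem_classSet_eight (F : Type) [Field F] : ∃ k ∈ classSet F 8, k ≤ 7 :=
  exists_mem_classSet_le F
    ![(.inl 0, .inl 1, .inr 2), (.inl 0, .inl 2, .inr 3), (.inl 1, .inl 2, .inr 4),
      (.inl 3, .inl 4, .inl 5), (.inl 2, .inl 3, .inr 5), (.inl 2, .inl 4, .inl 6),
      (.inl 0, .inl 3, .inr 6), (.inl 0, .inl 4, .inl 7), (.inl 1, .inl 3, .inr 7)]
    ![1, 1, 2, 3, 3, 4, 4, 4] {.inr 0, .inr 1} (by decide) (by decide) (by decide) (by decide)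
    (by decide) (by decide)

theorem two_mul_le_OmegaFn_add_of_mem_classSet {F : Type} [Field F] {n i j : ℕ}
    (h : i + j ∈ classSet F n) : 2 * n ≤ OmegaFn i + OmegaFn j := by
  obtain ⟨B, hfin, hnil, hdim, hcenter, hclass⟩ := h
  rw [← hdim]
  exact B.alg.finrank_le_OmegaFn_add hnil hcenter i j hclass.symm

theorem sInf_classSet_eq {F : Type} [Field F] {n c : ℕ} (hex : ∃ k ∈ classSet F n, k ≤ c)
    (hlow : ∀ k < c, OmegaFn (k / 2) + OmegaFn (k - k / 2) < 2 * n) :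
    sInf (classSet F n) = c := by
  obtain ⟨k, hk, hkc⟩ := hex
  refine le_antisymm ((Nat.sInf_le hk).trans hkc) ?_
  by_contra! hlt
  have hmem := Nat.sInf_mem ⟨k, hk⟩
  have hsplit : sInf (classSet F n) / 2 + (sInf (classSet F n) - sInf (classSet F n) / 2) =
      sInf (classSet F n) := by omega
  have := two_mul_le_OmegaFn_add_of_mem_classSet (hsplit.symm ▸ hmem)
  have := hlow _ hlt
  omega

theorem twelve_le_OmegaFn (m : ℕ) : 12 ≤ OmegaFn (m + 4) := by
  induction m with
  | zero => decide
  | succ m ih =>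
    have h : (12).choose 2 ≤ (OmegaFn (m + 4)).choose 2 := Nat.choose_le_choose 2 ih
    have h12 : (12).choose 2 = 66 := by decide
    have hrec : OmegaFn (m + 1 + 4) = 2 + (OmegaFn (m + 4)).choose 2 := rfl
    omega

/-- for any field `F` and `4 ≤ n ≤ 8`, there is a nilpotent SAA
over `F` of dimension `2n` with 2-dimensional center, and the minimum of the
nilpotency classes of all such algebras is `2m+1` if `Ω(m) < n ≤ (Ω(m)+Ω(m+1))/2`
and `2m+2` if `(Ω(m)+Ω(m+1))/2 < n ≤ Ω(m+1)`; explicitly, it is `5` for `n = 4`,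
`6` for `n = 5` and `7` for `n ∈ {6,7,8}`. -/
theorem stmt0 (F : Type) [Field F] (n : ℕ) (h1 : 4 ≤ n) (h2 : n ≤ 8) :
    (classSet F n).Nonempty ∧
    (∀ m : ℕ, OmegaFn m < n → n ≤ OmegaFn (m + 1) →
      sInf (classSet F n) =
        (if 2 * n ≤ OmegaFn m + OmegaFn (m + 1) then 2 * m + 1 else 2 * m + 2)) ∧
    sInf (classSet F n) = (if n = 4 then 5 else if n = 5 then 6 else 7) := by
  have key : (classSet F n).Nonempty ∧
      sInf (classSet F n) = (if n = 4 then 5 else if n = 5 then 6 else 7) := by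
    have hex : ∃ k ∈ classSet F n, k ≤ (if n = 4 then 5 else if n = 5 then 6 else 7) := by
      interval_cases n
      · exact exists_mem_classSet_four F
      · exact exists_mem_classSet_five F
      · exact exists_mem_classSet_six F
      · exact exists_mem_classSet_seven F
      · exact exists_mem_classSet_eight F
    refine ⟨hex.imp fun _ hk => hk.1, sInf_classSet_eq hex ?_⟩
    clear hex
    interval_cases n <;> decide
  refine ⟨key.1, fun m hm hm' => ?_, key.2⟩
  rw [key.2]
  have hm4 : m < 4 := by
    by_contra! h
    obtain ⟨r, rfl⟩ := Nat.exists_eq_add_of_le' h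
    have := twelve_le_OmegaFn r
    omega
  have e1 : OmegaFn 1 = 2 := by decide
  have e2 : OmegaFn 2 = 3 := by decide
  have e3 : OmegaFn 3 = 5 := by decide
  have e4 : OmegaFn 4 = 12 := by decide
  interval_cases m
  · simp only [Nat.reduceAdd, e1] at hm'
    omega
  · simp only [Nat.reduceAdd, e2] at hm'
    omega
  · simp only [Nat.reduceAdd, e2, e3] at hm hm' ⊢
    interval_cases n <;> rfl
  · simp only [Nat.reduceAdd, e3, e4] at hm hm' ⊢
    interval_cases n <;> rfl
end

section
/- Let L be a nilpotent symplectic alternating algebra. Then Z_i(L) = (L^{i+1})^⊥ for every i ≥ 0. -/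
namespace SAAStruct

variable {F : Type*} [Field F] {L : Type*} [AddCommGroup L] [Module F L]

theorem mem_ucs_succ (A : SAAStruct F L) {i : ℕ} {x : L} :
    x ∈ A.ucs (i + 1) ↔ ∀ y : L, A.mul x y ∈ A.ucs i :=
  Iff.rfl

theorem perp_top (A : SAAStruct F L) : A.perp ⊤ = ⊥ :=
  (Submodule.eq_bot_iff _).2 fun x hx => A.form_nondegen x fun y => hx y trivial

theorem mem_perp_lcs_succ (A : SAAStruct F L) {i : ℕ} {x : L} :
    x ∈ A.perp (A.lcs (i + 1)) ↔ ∀ y : L, A.mul x y ∈ A.perp (A.lcs i) := by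
  constructor
  · intro hx y u hu
    rw [← A.form_mul_right]
    exact hx _ (Submodule.subset_span ⟨u, hu, y, rfl⟩)
  · intro hx
    have hle : A.lcs (i + 1) ≤ LinearMap.ker (A.form x) := by
      refine Submodule.span_le.2 ?_
      rintro _ ⟨u, hu, v, rfl⟩
      exact (A.form_mul_right x u v).trans (hx v u hu)
    exact fun w hw => hle hw

theorem ucs_eq_perp_lcs (A : SAAStruct F L) (i : ℕ) : A.ucs i = A.perp (A.lcs i) := by
  induction i with
  | zero => exact A.perp_top.symm
  | succ i ih =>
    ext x
    rw [mem_ucs_succ, mem_perp_lcs_succ, ih]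

end SAAStruct

/-- for a nilpotent SAA, `Z_i(L) = (L^(i+1))^⊥` for every `i ≥ 0`.
(Here `A.lcs i = L^(i+1)` and `A.ucs i = Z_i(L)`.) -/
theorem stmt3 (F : Type*) [Field F] (L : Type*) [AddCommGroup L] [Module F L]
    [FiniteDimensional F L] (A : SAAStruct F L) (hnil : A.IsNilpotent) :
    ∀ i : ℕ, A.ucs i = A.perp (A.lcs i) :=
  A.ucs_eq_perp_lcs
end

section
/- Let L be a nilpotent symplectic alternating algebra with dim L > 2 and dim Z(L) = 2. Then Z(L) is isotropic. -/
namespace SAAStruct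

variable {F : Type*} [Field F] {L : Type*} [AddCommGroup L] [Module F L]

/-- Products are orthogonal to the center. -/
theorem form_mul_center (A : SAAStruct F L) {u : L} (hu : u ∈ A.center) (x y : L) :
    A.form (A.mul x y) u = 0 := by
  have hu' : A.mul u = 0 := hu
  rw [A.cyclic, A.mul_swap, hu']
  simp

/-- In a nilpotent algebra, a linear map vanishing on all products is injective as soon as it
is injective on the center. -/
theorem IsNilpotent.injective_of_center {A : SAAStruct F L} (hnil : A.IsNilpotent)
    {M : Type*} [AddCommGroup M] [Module F M] (f : L →ₗ[F] M)
    (hmul : ∀ x y, f (A.mul x y) = 0) (hcenter : ∀ x ∈ A.center, f x = 0 → x = 0) :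
    Function.Injective f := by
  obtain ⟨k, I, h0, hk, -, -, hstep⟩ := hnil
  have key : ∀ s, s ≤ k → ∀ x ∈ I s, f x = 0 → x = 0 := by
    intro s
    induction s with
    | zero =>
      intro _ x hx _
      simpa [h0] using hx
    | succ s ih =>
      intro hs x hx hfx
      refine hcenter x (LinearMap.ext fun y => ?_) hfx
      exact ih (by omega) _ (hstep s (by omega) x hx y) (hmul x y)
  exact (injective_iff_map_eq_zero f).2 fun x hx => key k le_rfl x (by simp [hk]) hx

end SAAStruct

/-- for a nilpotent SAA with `dim L > 2` and `dim Z(L) = 2`,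
the center is isotropic. -/
theorem stmt14 (F : Type*) [Field F] (L : Type*) [AddCommGroup L] [Module F L]
    [FiniteDimensional F L] (A : SAAStruct F L) (hnil : A.IsNilpotent)
    (hdim : 2 < Module.finrank F L) (hZ : Module.finrank F A.center = 2) :
    A.Isotropic A.center := by
  intro u hu v hv
  by_contra hc
  let f : L →ₗ[F] F × F := (A.form.flip u).prod (A.form.flip v)
  have hf : ∀ x, f x = (A.form x u, A.form x v) := fun _ => rfl
  have hsurj : Function.Surjective (f.domRestrict A.center) := by
    rintro ⟨a, b⟩
    refine ⟨(b / A.form u v) • ⟨u, hu⟩ - (a / A.form u v) • ⟨v, hv⟩, ?_⟩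
    simp [hf, A.form_alt, A.form_swap v u, hc]
  have hinj : Function.Injective (f.domRestrict A.center) :=
    (LinearMap.injective_iff_surjective_of_finrank_eq_finrank (by simp [hZ])).2 hsurj
  have hf_inj : Function.Injective f := by
    refine hnil.injective_of_center f (fun x y => ?_) fun x hx hfx => ?_
    · simp [hf, A.form_mul_center hu, A.form_mul_center hv]
    · simpa using (injective_iff_map_eq_zero _).1 hinj ⟨x, hx⟩ hfx
  have hle := LinearMap.finrank_le_finrank_of_injective hf_inj
  simp only [Module.finrank_prod, Module.finrank_self] at hle
  omega
end
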